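/- arXiv:1504.03772 — 5 statements merged into one kernel-verified Lean document; each statement's English description precedes it below -/
import Mathlib

section
/- Let α : ℝ → ℝ be continuous and let ε : ℝ → Matrix n n ℂ be differentiable on all of ℝ with ε′(x) = 2 ε(x)² + α(x) I for every x. If ε(0) is Hermitian (equal to its conjugate transpose), then ε(x) is Hermitian for every x ∈ ℝ. -/
open scoped Matrix

attribute [local instance] Matrix.linftyOpNormedRing Matrix.linftyOpNormedAlgebra

/-- If `ε : ℝ → Matrix n n ℂ` is a global solution of the reversibility equation
`ε'(x) = 2ε(x)² + α(x)I` with real `α` and Hermitian initial condition `ε(0)`, then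
`ε(x)` is Hermitian for all `x`. -/
theorem solution_stays_hermitian {n : ℕ}
    (α : ℝ → ℝ) (hα : Continuous α)
    (ε : ℝ → Matrix (Fin n) (Fin n) ℂ)
    (hderiv : ∀ x, HasDerivAt ε
      ((2 : ℂ) • ε x ^ 2 + (α x : ℂ) • (1 : Matrix (Fin n) (Fin n) ℂ)) x)
    (h0 : (ε 0).IsHermitian) :
    ∀ x, (ε x).IsHermitian := by
  intro x
  let L : Matrix (Fin n) (Fin n) ℂ →ₗ[ℝ] Matrix (Fin n) (Fin n) ℂ :=
    { toFun := fun A => Aᴴ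
      map_add' := fun A B => Matrix.conjTranspose_add A B
      map_smul' := fun r A => by
        ext i j
        simp [Matrix.conjTranspose_apply] }
  let C := LinearMap.toContinuousLinearMap L
  have hC : ∀ A, C A = Aᴴ := fun A => rfl
  have hderiv' : ∀ t, HasDerivAt (fun t => (ε t)ᴴ)
      ((2 : ℂ) • ((ε t)ᴴ) ^ 2 + (α t : ℂ) • (1 : Matrix (Fin n) (Fin n) ℂ)) t := by
    intro t
    have h := C.hasFDerivAt.comp_hasDerivAt t (hderiv t)
    have e : C ((2 : ℂ) • ε t ^ 2 + (α t : ℂ) • (1 : Matrix (Fin n) (Fin n) ℂ)) =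
        (2 : ℂ) • ((ε t)ᴴ) ^ 2 + (α t : ℂ) • (1 : Matrix (Fin n) (Fin n) ℂ) := by
      rw [hC]
      simp [Matrix.conjTranspose_add, Matrix.conjTranspose_smul, Matrix.conjTranspose_pow]
    exact HasDerivAt.congr_deriv h e
  have hc : Continuous ε := continuous_iff_continuousAt.2 fun t => (hderiv t).continuousAt
  have hc' : Continuous fun t => (ε t)ᴴ :=
    continuous_iff_continuousAt.2 fun t => (hderiv' t).continuousAt
  obtain ⟨M₁, h₁⟩ := (isCompact_Icc (a := -(|x| + 1)) (b := |x| + 1)).exists_bound_of_continuousOn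
    hc.continuousOn
  obtain ⟨M₂, h₂⟩ := (isCompact_Icc (a := -(|x| + 1)) (b := |x| + 1)).exists_bound_of_continuousOn
    hc'.continuousOn
  let M := max (max M₁ M₂) 0
  have hM : 0 ≤ M := le_max_right _ _
  have hx := neg_abs_le x
  have hx' := le_abs_self x
  have hx0 := abs_nonneg x
  have key := ODE_solution_unique_of_mem_Ioo (f := fun t => (ε t)ᴴ) (g := ε)
    (v := fun t A => (2 : ℂ) • A ^ 2 + (α t : ℂ) • (1 : Matrix (Fin n) (Fin n) ℂ))
    (s := fun _ => {A | ‖A‖ ≤ M}) (K := ⟨4 * M, by positivity⟩) (t₀ := 0)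
    (a := -(|x| + 1)) (b := |x| + 1) ?_ ⟨by linarith, by linarith⟩
    (fun t ht => ⟨hderiv' t, (h₂ t (Set.Ioo_subset_Icc_self ht)).trans
      ((le_max_right _ _).trans (le_max_left _ _))⟩)
    (fun t ht => ⟨hderiv t, (h₁ t (Set.Ioo_subset_Icc_self ht)).trans
      ((le_max_left _ _).trans (le_max_left _ _))⟩) h0
  · exact key (show x ∈ Set.Ioo _ _ from ⟨by linarith, by linarith⟩)
  · intro t _
    refine LipschitzOnWith.of_dist_le_mul fun A hA B hB => ?_
    have hA' : ‖A‖ ≤ M := hA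
    have hB' : ‖B‖ ≤ M := hB
    rw [dist_eq_norm, dist_eq_norm]
    have e : ((2 : ℂ) • A ^ 2 + (α t : ℂ) • (1 : Matrix (Fin n) (Fin n) ℂ)) -
        ((2 : ℂ) • B ^ 2 + (α t : ℂ) • (1 : Matrix (Fin n) (Fin n) ℂ)) =
        (2 : ℂ) • (A * (A - B) + (A - B) * B) := by
      rw [add_sub_add_right_eq_sub, ← smul_sub]
      congr 1
      noncomm_ring
    change ‖((2 : ℂ) • A ^ 2 + (α t : ℂ) • (1 : Matrix (Fin n) (Fin n) ℂ)) -
        ((2 : ℂ) • B ^ 2 + (α t : ℂ) • (1 : Matrix (Fin n) (Fin n) ℂ))‖ ≤ 4 * M * ‖A - B‖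
    rw [e, norm_smul]
    have n1 := norm_add_le (A * (A - B)) ((A - B) * B)
    have n2 := norm_mul_le A (A - B)
    have n3 := norm_mul_le (A - B) B
    have n4 := mul_le_mul_of_nonneg_right hA' (norm_nonneg (A - B))
    have n5 := mul_le_mul_of_nonneg_left hB' (norm_nonneg (A - B))
    have n6 : ‖(2 : ℂ)‖ = 2 := by simp
    rw [n6]
    linarith
end

section
/- Let f : ℝ → ℝ be differentiable on all of ℝ and satisfy the Riccati equation f′(x) = 2 f(x)² − 1/2 for every x ∈ ℝ. Then exactly one of the following holds: f is the constant function 1/2, f is the constant function −1/2, or there exists c ∈ ℝ such that f(x) = −(1/2) tanh(x − c) for all x. -/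
lemma riccati_coeff_nonneg (P Q : ℝ)
    (h : ∀ x : ℝ, 0 < P * Real.exp x + Q * Real.exp (-x)) : 0 ≤ P := by
  by_contra! hP
  have hx := h (|Q| / (-P))
  set x := |Q| / (-P) with hxd
  have hPx : P * x = -|Q| := by have := hP.ne; rw [hxd]; field_simp
  have h1 : 0 < (P * Real.exp x + Q * Real.exp (-x)) * Real.exp x :=
    mul_pos hx (Real.exp_pos _)
  have h2 : (P * Real.exp x + Q * Real.exp (-x)) * Real.exp x = P * Real.exp (2 * x) + Q := by
    rw [add_mul, mul_assoc, mul_assoc, ← Real.exp_add, ← Real.exp_add]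
    simp [two_mul]
  have h3 := Real.add_one_le_exp (2 * x)
  have h4 := mul_le_mul_of_nonpos_left h3 hP.le
  have h5 := le_abs_self Q
  have h6 := abs_nonneg Q
  nlinarith

/-- Classification of global solutions of the Riccati equation `f' = 2f² - 1/2` on `ℝ`:
`f` is constant `1/2`, constant `-1/2`, or `f(x) = -(1/2) tanh(x - c)` for some `c`. -/
theorem riccati_global_solutions (f : ℝ → ℝ)
    (hf : ∀ x, HasDerivAt f (2 * f x ^ 2 - 1 / 2) x) :
    (∀ x, f x = 1 / 2) ∨ (∀ x, f x = -(1 / 2)) ∨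
      ∃ c : ℝ, ∀ x, f x = -(1 / 2) * Real.tanh (x - c) := by
  have hc : Continuous f := continuous_iff_continuousAt.2 fun x => (hf x).continuousAt
  obtain ⟨u, hu0, hu⟩ : ∃ u : ℝ → ℝ, (∀ x, 0 < u x) ∧
      ∀ x, HasDerivAt u (-2 * f x * u x) x := by
    refine ⟨fun x => Real.exp (-2 * ∫ t in (0:ℝ)..x, f t), fun x => Real.exp_pos _, fun x => ?_⟩
    have h := ((hc.integral_hasStrictDerivAt 0 x).hasDerivAt.const_mul (-2)).exp
    convert h using 1
    ring
  have hP : ∀ x, (1 - 2 * f x) * u x * Real.exp (-x) = (1 - 2 * f 0) * u 0 * Real.exp (-0) := by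
    have hd : ∀ x, HasDerivAt (fun x => (1 - 2 * f x) * u x * Real.exp (-x)) 0 x := fun x => by
      refine HasDerivAt.congr_deriv (((((hf x).const_mul 2).const_sub 1).mul (hu x)).mul (hasDerivAt_neg x).exp) ?_
      simp only [Pi.mul_apply]; ring
    exact fun x => is_const_of_deriv_eq_zero (fun x => (hd x).differentiableAt)
      (fun x => (hd x).deriv) x 0
  have hQ : ∀ x, (1 + 2 * f x) * u x * Real.exp x = (1 + 2 * f 0) * u 0 * Real.exp 0 := by
    have hd : ∀ x, HasDerivAt (fun x => (1 + 2 * f x) * u x * Real.exp x) 0 x := fun x => by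
      refine HasDerivAt.congr_deriv (((((hf x).const_mul 2).const_add 1).mul (hu x)).mul (Real.hasDerivAt_exp x)) ?_
      simp only [Pi.mul_apply]; ring
    exact fun x => is_const_of_deriv_eq_zero (fun x => (hd x).differentiableAt)
      (fun x => (hd x).deriv) x 0
  generalize (1 - 2 * f 0) * u 0 * Real.exp (-0) = P at hP
  generalize (1 + 2 * f 0) * u 0 * Real.exp 0 = Q at hQ
  have hP' : ∀ x, (1 - 2 * f x) * u x = P * Real.exp x := fun x => by
    rw [← hP x, mul_assoc _ (Real.exp (-x)), ← Real.exp_add]; simp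
  have hQ' : ∀ x, (1 + 2 * f x) * u x = Q * Real.exp (-x) := fun x => by
    rw [← hQ x, mul_assoc _ (Real.exp x), ← Real.exp_add]; simp
  have hpos : ∀ x : ℝ, 0 < P * Real.exp x + Q * Real.exp (-x) := fun x => by
    rw [← hP', ← hQ']; linarith [hu0 x]
  have P0 : 0 ≤ P := riccati_coeff_nonneg P Q hpos
  have Q0 : 0 ≤ Q := riccati_coeff_nonneg Q P fun x => by
    have := hpos (-x); rw [neg_neg] at this; linarith
  rcases P0.eq_or_lt with hp | hp
  · left
    intro x
    have := hP' x
    rw [← hp, zero_mul] at this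
    have := (mul_eq_zero.1 this).resolve_right (hu0 x).ne'
    linarith
  rcases Q0.eq_or_lt with hq | hq
  · right; left
    intro x
    have := hQ' x
    rw [← hq, zero_mul] at this
    have := (mul_eq_zero.1 this).resolve_right (hu0 x).ne'
    linarith
  right; right
  refine ⟨(Real.log Q - Real.log P) / 2, fun x => ?_⟩
  set c := (Real.log Q - Real.log P) / 2 with hcd
  set m := (Real.log Q + Real.log P) / 2 with hmd
  have e1 : P * Real.exp x = Real.exp m * Real.exp (x - c) := by
    nth_rewrite 1 [← Real.exp_log hp]
    rw [← Real.exp_add, ← Real.exp_add]; congr 1; rw [hcd, hmd]; ring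
  have e2 : Q * Real.exp (-x) = Real.exp m * Real.exp (-(x - c)) := by
    nth_rewrite 1 [← Real.exp_log hq]
    rw [← Real.exp_add, ← Real.exp_add]; congr 1; rw [hcd, hmd]; ring
  have a1 := hP' x
  have a2 := hQ' x
  rw [e1] at a1
  rw [e2] at a2
  have hm := Real.exp_pos m
  rw [Real.tanh_eq_sinh_div_cosh, Real.sinh_eq, Real.cosh_eq]
  have hA := Real.exp_pos (x - c)
  have hB := Real.exp_pos (-(x - c))
  generalize Real.exp (x - c) = A at *
  generalize Real.exp (-(x - c)) = B at *
  have hS : A + B ≠ 0 := by positivity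
  have key : 2 * f x * (A + B) = B - A := by
    have hu2 : 2 * u x = Real.exp m * (A + B) := by linarith
    apply mul_left_cancel₀ hm.ne'
    linear_combination a2 - a1 - 2 * f x * hu2
  field_simp
  linarith
end

section
/- Let Π₁, …, Π_m be a complete family of pairwise orthogonal projections on ℂⁿ and let c₁, …, c_m ∈ ℝ. Define ε(x) = −(1/2) Σ_{i=1}^m tanh(x − c_i) Π_i. Then ε is differentiable and satisfies the reversibility equation ε′(x) = 2 ε(x)² − (1/2) I for every x ∈ ℝ. -/
open scoped Matrix
open Finset

attribute [local instance] Matrix.linftyOpNormedRing Matrix.linftyOpNormedAlgebra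

theorem aux_tanh (y : ℝ) : HasDerivAt Real.tanh (1 - Real.tanh y ^ 2) y := by
  have h : HasDerivAt (fun z => Real.sinh z / Real.cosh z) _ y :=
    (Real.hasDerivAt_sinh y).div (Real.hasDerivAt_cosh y) (Real.cosh_pos y).ne'
  have e : Real.tanh = fun z => Real.sinh z / Real.cosh z :=
    funext Real.tanh_eq_sinh_div_cosh
  rw [e]
  convert h using 1
  have := (Real.cosh_pos y).ne'
  field_simp

/-- Given a complete family of pairwise orthogonal projections `P i` on `ℂⁿ` and offsets
`c i`, the operator `ε(x) = -(1/2) ∑ᵢ tanh(x - cᵢ) Pᵢ` satisfies the reversibility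
equation `ε'(x) = 2ε(x)² - (1/2)I`. -/
theorem tanh_sum_satisfies_reversibility {n m : ℕ}
    (P : Fin m → Matrix (Fin n) (Fin n) ℂ)
    (hherm : ∀ i, (P i).IsHermitian)
    (hproj : ∀ i, P i * P i = P i)
    (horth : ∀ i j, i ≠ j → P i * P j = 0)
    (hsum : ∑ i, P i = 1)
    (c : Fin m → ℝ)
    (ε : ℝ → Matrix (Fin n) (Fin n) ℂ)
    (hε : ε = fun x => (-(2⁻¹ : ℂ)) • ∑ i, (Real.tanh (x - c i) : ℂ) • P i) :
    ∀ x, HasDerivAt ε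
      ((2 : ℂ) • ε x ^ 2 - (2⁻¹ : ℂ) • (1 : Matrix (Fin n) (Fin n) ℂ)) x := by
  intro x
  have hs : (∑ i, (Real.tanh (x - c i) : ℂ) • P i) ^ 2
      = ∑ i, ((Real.tanh (x - c i) : ℂ) ^ 2) • P i := by
    rw [sq, Finset.sum_mul]
    refine Finset.sum_congr rfl fun i _ => ?_
    rw [Finset.mul_sum, Finset.sum_eq_single i]
    · rw [smul_mul_smul_comm, hproj, sq]
    · intro j _ hj
      rw [smul_mul_smul_comm, horth i j hj.symm, smul_zero]
    · simp
  have hd : ∀ i, HasDerivAt (fun x : ℝ => (Real.tanh (x - c i) : ℂ) • P i)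
      (((1 - Real.tanh (x - c i) ^ 2 : ℝ) : ℂ) • P i) x := fun i =>
    ((aux_tanh (x - c i)).comp_sub_const x (c i)).ofReal_comp.smul_const (P i)
  have hD := (HasDerivAt.fun_sum (u := Finset.univ) fun i _ => hd i).const_smul (-(2⁻¹ : ℂ))
  have key : (2 : ℂ) • ε x ^ 2 - (2⁻¹ : ℂ) • (1 : Matrix (Fin n) (Fin n) ℂ)
      = (-(2⁻¹ : ℂ)) • ∑ i, ((1 - Real.tanh (x - c i) ^ 2 : ℝ) : ℂ) • P i := by
    rw [hε]
    beta_reduce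
    rw [smul_pow, hs]
    push_cast
    simp only [sub_smul, one_smul, Finset.sum_sub_distrib, hsum]
    module
  rw [key, hε]
  exact hD
end

section
/- Let Π₁, …, Π_m be a complete family of pairwise orthogonal projections on ℂⁿ, let c₁, …, c_m ∈ ℝ, and let ε(x) = −(1/2) Σ_{i=1}^m tanh(x − c_i) Π_i. Define the total walk operator M(x) = Σ_{i=1}^m √(cosh(x − c_i)/cosh(c_i)) Π_i. Then M(0) = I, M is differentiable with M′(x) = −ε(x) M(x) for every x, and M(x) commutes with ε(y) for all x, y ∈ ℝ. -/
open scoped Matrix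
open Finset

attribute [local instance] Matrix.linftyOpNormedRing Matrix.linftyOpNormedAlgebra

/-- Given a complete family of pairwise orthogonal projections `P i` on `ℂⁿ`, offsets
`c i`, and `ε(x) = -(1/2) ∑ᵢ tanh(x - cᵢ) Pᵢ`, the total walk operator
`M(x) = ∑ᵢ √(cosh(x - cᵢ)/cosh(cᵢ)) Pᵢ` satisfies `M(0) = I`, `M'(x) = -ε(x) M(x)`, and
`M(x)` commutes with `ε(y)` for all `x, y`. -/
theorem total_walk_operator_projections {n m : ℕ}
    (P : Fin m → Matrix (Fin n) (Fin n) ℂ)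
    (hherm : ∀ i, (P i).IsHermitian)
    (hproj : ∀ i, P i * P i = P i)
    (horth : ∀ i j, i ≠ j → P i * P j = 0)
    (hsum : ∑ i, P i = 1)
    (c : Fin m → ℝ)
    (ε : ℝ → Matrix (Fin n) (Fin n) ℂ)
    (hε : ε = fun x => (-(2⁻¹ : ℂ)) • ∑ i, (Real.tanh (x - c i) : ℂ) • P i)
    (M : ℝ → Matrix (Fin n) (Fin n) ℂ)
    (hM : M = fun x =>
      ∑ i, (Real.sqrt (Real.cosh (x - c i) / Real.cosh (c i)) : ℂ) • P i) :
    M 0 = 1 ∧ (∀ x, HasDerivAt M (-(ε x * M x)) x) ∧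
      ∀ x y, M x * ε y = ε y * M x := by
  have key : ∀ a b : Fin m → ℂ,
      (∑ i, a i • P i) * (∑ i, b i • P i) = ∑ i, (a i * b i) • P i := by
    intro a b
    rw [Finset.sum_mul]
    refine Finset.sum_congr rfl fun i _ => ?_
    rw [Finset.mul_sum, Finset.sum_eq_single i]
    · rw [smul_mul_smul_comm, hproj]
    · intro j _ hj
      rw [smul_mul_smul_comm, horth i j (Ne.symm hj), smul_zero]
    · simp
  subst hε hM
  refine ⟨?_, ?_, ?_⟩
  · have h : ∀ i, Real.cosh (0 - c i) / Real.cosh (c i) = 1 := fun i => by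
      rw [zero_sub, Real.cosh_neg, div_self (Real.cosh_pos _).ne']
    simp only [h, Real.sqrt_one, Complex.ofReal_one, one_smul]
    exact hsum
  · intro x
    have hd : ∀ i, HasDerivAt
        (fun x : ℝ => ((Real.sqrt (Real.cosh (x - c i) / Real.cosh (c i)) : ℝ) : ℂ))
        (((2⁻¹ * (Real.tanh (x - c i) *
          Real.sqrt (Real.cosh (x - c i) / Real.cosh (c i))) : ℝ)) : ℂ) x := by
      intro i
      apply HasDerivAt.ofReal_comp
      have hp := Real.cosh_pos (x - c i)
      have hq := Real.cosh_pos (c i)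
      have hr : 0 < Real.cosh (x - c i) / Real.cosh (c i) := div_pos hp hq
      have h1 := ((((hasDerivAt_id x).sub_const (c i)).cosh).div_const
        (Real.cosh (c i))).sqrt hr.ne'
      refine h1.congr_deriv ?_
      simp only [id]
      have hs := Real.sqrt_pos.2 hr
      rw [div_eq_iff (by positivity), Real.tanh_eq_sinh_div_cosh]
      have h2 := Real.mul_self_sqrt hr.le
      generalize Real.sqrt (Real.cosh (x - c i) / Real.cosh (c i)) = s at *
      calc _ = Real.sinh (x - c i) / Real.cosh (x - c i) *
              (Real.cosh (x - c i) / Real.cosh (c i)) := by field_simp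
        _ = _ := by rw [← h2]; ring
    have h3 := HasDerivAt.fun_sum (u := Finset.univ)
      (fun i _ => (hd i).smul_const (P i))
    refine h3.congr_deriv ?_
    simp only [smul_mul_assoc]
    rw [key, neg_smul, neg_neg, Finset.smul_sum]
    refine Finset.sum_congr rfl fun i _ => ?_
    rw [smul_smul]
    push_cast
    rfl
  · intro x y
    simp only [smul_mul_assoc, mul_smul_comm]
    rw [key, key]
    simp only [mul_comm]
end

section
/- Let D : ℝ → Matrix n n ℂ and A : ℝ → Matrix n n ℂ be continuous, with D(x) a diagonal matrix for every x. Assume the compatibility condition: for all indices i ≠ j, if the functions x ↦ D(x)_{ii} and x ↦ D(x)_{jj} are not identically equal, then A(x)_{ij} = 0 for all x. Let N : ℝ → Matrix n n ℂ be differentiable with N(0) = I and N′(x) = −D(x) N(x) − i [A(x), N(x)] for every x, where [·,·] is the matrix commutator. Then N(x) is diagonal for every x, and its diagonal entries are N(x)_{ii} = exp(−∫₀ˣ D(y)_{ii} dy). -/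
open scoped Matrix

attribute [local instance] Matrix.linftyOpNormedRing Matrix.linftyOpNormedAlgebra

/-- Let `D(x)` be diagonal and `A(x)` satisfy the compatibility condition that `A(x)ᵢⱼ = 0`
whenever the diagonal entries `D(·)ᵢᵢ` and `D(·)ⱼⱼ` are not identically equal. Then the
solution of `N'(x) = -D(x)N(x) - i[A(x), N(x)]` with `N(0) = I` is diagonal with entries
`N(x)ᵢᵢ = exp(-∫₀ˣ D(y)ᵢᵢ dy)`. -/
theorem diagonal_solution_of_compatible_ode {n : ℕ}
    (D A N : ℝ → Matrix (Fin n) (Fin n) ℂ)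
    (hD : Continuous D) (hA : Continuous A)
    (hdiag : ∀ x, (D x).IsDiag)
    (hcompat : ∀ i j : Fin n, i ≠ j → ¬(∀ x, D x i i = D x j j) → ∀ x, A x i j = 0)
    (hN0 : N 0 = 1)
    (hderiv : ∀ x, HasDerivAt N
      (-(D x * N x) - Complex.I • (A x * N x - N x * A x)) x) :
    ∀ x, (N x).IsDiag ∧ ∀ i, N x i i = Complex.exp (-(∫ y in (0 : ℝ)..x, D y i i)) := by
  let g : ℝ → Fin n → ℂ := fun x i => Complex.exp (-(∫ y in (0 : ℝ)..x, D y i i))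
  have hDc : ∀ i, Continuous fun y => D y i i := fun i => hD.matrix_elem i i
  have hg : ∀ x, HasDerivAt g (fun i => -(D x i i) * g x i) x := by
    intro x
    rw [hasDerivAt_pi]
    intro i
    have h1 := ((hDc i).integral_hasStrictDerivAt 0 x).hasDerivAt
    have h2 := h1.neg.cexp
    refine h2.congr_deriv ?_
    simp only [g, Pi.neg_apply]
    ring
  have hcomm : ∀ x, A x * Matrix.diagonal (g x) - Matrix.diagonal (g x) * A x = 0 := by
    intro x
    ext i j
    simp only [Matrix.sub_apply, Matrix.mul_diagonal, Matrix.diagonal_mul, Matrix.zero_apply]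
    by_cases hij : i = j
    · subst hij; ring
    by_cases h : ∀ x, D x i i = D x j j
    · have : g x i = g x j := by simp only [g, h]
      rw [this]; ring
    · rw [hcompat i j hij h x]; ring
  have hG : ∀ x, HasDerivAt (fun x => Matrix.diagonal (g x))
      (-(D x * Matrix.diagonal (g x)) - Complex.I • (A x * Matrix.diagonal (g x) -
        Matrix.diagonal (g x) * A x)) x := by
    intro x
    have hL := ((Matrix.diagonalLinearMap (Fin n) ℝ ℂ).toContinuousLinearMap.hasFDerivAt
      (x := g x)).comp_hasDerivAt x (hg x)
    refine hL.congr_deriv ?_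
    rw [hcomm, smul_zero, sub_zero]
    ext i j
    change Matrix.diagonal (fun i => -(D x i i) * g x i) i j = _
    simp only [Matrix.neg_apply, Matrix.mul_diagonal]
    by_cases hij : i = j
    · subst hij; simp
    · simp [hij, hdiag x hij]
  have hkey : ∀ x, N x = Matrix.diagonal (g x) := by
    intro x
    have hB : Continuous fun t => ‖D t‖ + 2 * ‖A t‖ := by fun_prop
    obtain ⟨C, hC⟩ := (isCompact_Icc (a := -(|x| + 1)) (b := |x| + 1)).exists_bound_of_continuousOn
      hB.continuousOn
    have hlip : ∀ t ∈ Set.Ioo (-(|x| + 1)) (|x| + 1), LipschitzOnWith C.toNNReal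
        (fun M : Matrix (Fin n) (Fin n) ℂ => -(D t * M) - Complex.I • (A t * M - M * A t))
        Set.univ := by
      intro t ht
      have hb := (le_abs_self _).trans (hC t (Set.Ioo_subset_Icc_self ht))
      refine LipschitzOnWith.of_dist_le_mul fun M _ M' _ => ?_
      rw [dist_eq_norm, dist_eq_norm]
      have e : -(D t * M) - Complex.I • (A t * M - M * A t) -
          (-(D t * M') - Complex.I • (A t * M' - M' * A t)) =
          -(D t * (M - M')) - Complex.I • (A t * (M - M') - (M - M') * A t) := by
        simp only [mul_sub, sub_mul, smul_sub]; abel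
      rw [e]
      have h1 := norm_mul_le (D t) (M - M')
      have h2 := norm_mul_le (A t) (M - M')
      have h3 := norm_mul_le (M - M') (A t)
      have h4 := norm_sub_le (A t * (M - M')) ((M - M') * A t)
      have h5 := norm_sub_le (-(D t * (M - M'))) (Complex.I • (A t * (M - M') - (M - M') * A t))
      rw [norm_neg, norm_smul, Complex.norm_I, one_mul] at h5
      have h6 := mul_le_mul_of_nonneg_right (hb.trans (Real.le_coe_toNNReal C))
        (norm_nonneg (M - M'))
      linarith
    have := ODE_solution_unique_of_mem_Ioo (t₀ := 0) (f := N)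
      (g := fun x => Matrix.diagonal (g x)) hlip
      ⟨by linarith [abs_nonneg x], by linarith [abs_nonneg x]⟩
      (fun t _ => ⟨hderiv t, trivial⟩) (fun t _ => ⟨hG t, trivial⟩)
      (by simp [hN0, g])
    exact this ⟨by linarith [neg_abs_le x], by linarith [le_abs_self x]⟩
  intro x
  rw [hkey x]
  exact ⟨Matrix.isDiag_diagonal _, fun i => by simp [g]⟩
end
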